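/- arXiv:0805.3765 — 7 statements merged into one kernel-verified Lean document; each statement's English description precedes it below -/
import Mathlib

section
/- Let x0, y0 be real numbers and let u, a, f be continuous nonnegative real-valued functions on [x0,∞)×[y0,∞), with a nondecreasing in each of its variables. If u(x,y) ≤ a(x,y) + ∫_{x0}^{x} ∫_{y0}^{y} f(t,s) u(t,s) dt ds for all (x,y) ∈ [x0,∞)×[y0,∞), then u(x,y) ≤ a(x,y) · exp( ∫_{x0}^{x} ∫_{y0}^{y} f(t,s) dt ds ) for all (x,y) ∈ [x0,∞)×[y0,∞). -/
/-- Differential form of Gronwall's inequality with a variable continuous coefficient. -/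
theorem le_mul_exp_integral_of_deriv_le {w w' g : ℝ → ℝ} {x₀ x₁ : ℝ} (hx : x₀ ≤ x₁)
    (hg : Continuous g) (hw : ∀ x, HasDerivAt w (w' x) x)
    (hle : ∀ x ∈ Set.Icc x₀ x₁, w' x ≤ g x * w x) :
    w x₁ ≤ w x₀ * Real.exp (∫ t in x₀..x₁, g t) := by
  have hG (x : ℝ) : HasDerivAt (fun x => ∫ t in x₀..x, g t) (g x) x :=
    hg.integral_hasStrictDerivAt x₀ x |>.hasDerivAt
  have hD (x : ℝ) := (hw x).mul (hG x).neg.exp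
  have hanti := antitoneOn_of_deriv_nonpos (convex_Icc x₀ x₁)
    (fun x _ => (hD x).continuousAt.continuousWithinAt)
    (fun x _ => (hD x).differentiableAt.differentiableWithinAt)
    (fun x hx => by
      rw [(hD x).deriv]
      have h₁ := hle x (interior_subset hx)
      have h₂ := mul_le_mul_of_nonneg_right h₁
        (Real.exp_pos (-∫ t in x₀..x, g t)).le
      simp only [Pi.neg_apply] at *
      linarith)
  have hend := hanti (Set.left_mem_Icc.2 hx) (Set.right_mem_Icc.2 hx) hx
  simp only [Pi.mul_apply, Pi.neg_apply, intervalIntegral.integral_same, neg_zero, Real.exp_zero,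
    mul_one] at hend
  rwa [Real.exp_neg, ← div_eq_mul_inv, div_le_iff₀ (Real.exp_pos _)] at hend

/-- Gronwall's inequality on a rectangle, for continuous nonnegative functions on the plane and a
constant inhomogeneous term. -/
theorem gronwall_rectangle {u f : ℝ → ℝ → ℝ} {x₀ x₁ y₀ y₁ A : ℝ} (hx : x₀ ≤ x₁) (hy : y₀ ≤ y₁)
    (hu : Continuous (Function.uncurry u)) (hf : Continuous (Function.uncurry f))
    (hu_nonneg : ∀ x y, 0 ≤ u x y) (hf_nonneg : ∀ x y, 0 ≤ f x y)
    (h : ∀ x ∈ Set.Icc x₀ x₁, ∀ y ∈ Set.Icc y₀ y₁,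
      u x y ≤ A + ∫ t in x₀..x, ∫ s in y₀..y, f t s * u t s) :
    u x₁ y₁ ≤ A * Real.exp (∫ t in x₀..x₁, ∫ s in y₀..y₁, f t s) := by
  have hfu : Continuous (Function.uncurry fun t s => f t s * u t s) := hf.mul hu
  have hcont (y : ℝ) : Continuous fun t => ∫ s in y₀..y, f t s * u t s :=
    intervalIntegral.continuous_parametric_intervalIntegral_of_continuous' hfu y₀ y
  have hslice {F : ℝ → ℝ → ℝ} (hF : Continuous (Function.uncurry F)) (t : ℝ) :
      Continuous (F t) := hF.comp (Continuous.prodMk_right t)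
  have hbound (x : ℝ) (hx' : x ∈ Set.Icc x₀ x₁) (y : ℝ) (hy' : y ∈ Set.Icc y₀ y₁) :
      u x y ≤ A + ∫ t in x₀..x, ∫ s in y₀..y₁, f t s * u t s := by
    refine (h x hx' y hy').trans (add_le_add le_rfl ?_)
    refine intervalIntegral.integral_mono_on hx'.1 ((hcont y).intervalIntegrable _ _)
      ((hcont y₁).intervalIntegrable _ _) fun t _ => ?_
    exact intervalIntegral.integral_mono_interval le_rfl hy'.1 hy'.2
      (Filter.Eventually.of_forall fun s => mul_nonneg (hf_nonneg t s) (hu_nonneg t s))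
      ((hslice hfu t).intervalIntegrable _ _)
  have hw (x : ℝ) : HasDerivAt (fun x => A + ∫ t in x₀..x, ∫ s in y₀..y₁, f t s * u t s)
      (∫ s in y₀..y₁, f x s * u x s) x :=
    ((hcont y₁).integral_hasStrictDerivAt x₀ x).hasDerivAt.const_add A
  have key := le_mul_exp_integral_of_deriv_le hx
    (intervalIntegral.continuous_parametric_intervalIntegral_of_continuous' hf y₀ y₁) hw
    (fun x hx' => by
      rw [← intervalIntegral.integral_mul_const]
      exact intervalIntegral.integral_mono_on hy ((hslice hfu x).intervalIntegrable _ _)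
        (((hslice hf x).mul continuous_const).intervalIntegrable _ _) fun s hs =>
          mul_le_mul_of_nonneg_left (hbound x hx' s hs) (hf_nonneg x s))
  simp only [intervalIntegral.integral_same, add_zero] at key
  exact (hbound x₁ ⟨hx, le_rfl⟩ y₁ ⟨hy, le_rfl⟩).trans key

/-- Clamping the arguments extends a continuous function on a quadrant to the plane. -/
theorem continuous_clamp_quadrant {F : ℝ → ℝ → ℝ} {x₀ y₀ : ℝ}
    (hF : ContinuousOn (fun p : ℝ × ℝ => F p.1 p.2) (Set.Ici x₀ ×ˢ Set.Ici y₀)) :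
    Continuous (Function.uncurry fun x y => F (max x₀ x) (max y₀ y)) :=
  hF.comp_continuous (f := fun p : ℝ × ℝ => (max x₀ p.1, max y₀ p.2)) (by fun_prop)
    fun _ => ⟨Set.mem_Ici.2 (le_max_left _ _), Set.mem_Ici.2 (le_max_left _ _)⟩

/-- Clamping the arguments to a quadrant does not change integrals over rectangles inside it. -/
theorem integral_clamp_quadrant (F : ℝ → ℝ → ℝ) {x₀ y₀ x y : ℝ} (hx : x₀ ≤ x) (hy : y₀ ≤ y) :
    ∫ t in x₀..x, ∫ s in y₀..y, F (max x₀ t) (max y₀ s) =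
      ∫ t in x₀..x, ∫ s in y₀..y, F t s := by
  refine intervalIntegral.integral_congr fun t ht => intervalIntegral.integral_congr fun s hs => ?_
  rw [Set.uIcc_of_le hx] at ht
  rw [Set.uIcc_of_le hy] at hs
  simp only [max_eq_right ht.1, max_eq_right hs.1]

/-- Linear Gronwall inequality in two real variables (Corollary of Theorem 1,
specialized to 𝕋₁ = 𝕋₂ = ℝ). -/
theorem gronwall_two_vars_real (x0 y0 : ℝ) (u a f : ℝ → ℝ → ℝ)
    (hu_cont : ContinuousOn (fun p : ℝ × ℝ => u p.1 p.2) (Set.Ici x0 ×ˢ Set.Ici y0))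
    (ha_cont : ContinuousOn (fun p : ℝ × ℝ => a p.1 p.2) (Set.Ici x0 ×ˢ Set.Ici y0))
    (hf_cont : ContinuousOn (fun p : ℝ × ℝ => f p.1 p.2) (Set.Ici x0 ×ˢ Set.Ici y0))
    (hu_nonneg : ∀ x ∈ Set.Ici x0, ∀ y ∈ Set.Ici y0, 0 ≤ u x y)
    (ha_nonneg : ∀ x ∈ Set.Ici x0, ∀ y ∈ Set.Ici y0, 0 ≤ a x y)
    (hf_nonneg : ∀ x ∈ Set.Ici x0, ∀ y ∈ Set.Ici y0, 0 ≤ f x y)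
    (ha_mono_fst : ∀ y ∈ Set.Ici y0, MonotoneOn (fun x => a x y) (Set.Ici x0))
    (ha_mono_snd : ∀ x ∈ Set.Ici x0, MonotoneOn (fun y => a x y) (Set.Ici y0))
    (h : ∀ x ∈ Set.Ici x0, ∀ y ∈ Set.Ici y0,
      u x y ≤ a x y + ∫ t in x0..x, ∫ s in y0..y, f t s * u t s) :
    ∀ x ∈ Set.Ici x0, ∀ y ∈ Set.Ici y0,
      u x y ≤ a x y * Real.exp (∫ t in x0..x, ∫ s in y0..y, f t s) := by
  intro x hx y hy
  have key := gronwall_rectangle (A := a x y) hx hy (continuous_clamp_quadrant hu_cont)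
    (continuous_clamp_quadrant hf_cont)
    (fun t s => hu_nonneg _ (Set.mem_Ici.2 (le_max_left _ _)) _ (Set.mem_Ici.2 (le_max_left _ _)))
    (fun t s => hf_nonneg _ (Set.mem_Ici.2 (le_max_left _ _)) _ (Set.mem_Ici.2 (le_max_left _ _)))
    (fun t ht s hs => by
      rw [integral_clamp_quadrant (fun t s => f t s * u t s) ht.1 hs.1, max_eq_right ht.1,
        max_eq_right hs.1]
      have h₁ := h t ht.1 s hs.1
      have h₂ := ha_mono_fst s hs.1 ht.1 hx ht.2
      have h₃ := ha_mono_snd x hx hs.1 hy hs.2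
      simp only at h₂ h₃
      linarith)
  rwa [integral_clamp_quadrant f hx hy, max_eq_right hx, max_eq_right hy] at key
end

section
/- Let m0, n0 be integers and let u, a, f be nonnegative real-valued functions defined for integer pairs (m,n) with m ≥ m0 and n ≥ n0, with a nondecreasing in each of its variables. If u(m,n) ≤ a(m,n) + Σ_{s=m0}^{m-1} Σ_{t=n0}^{n-1} f(s,t) u(s,t) for all such (m,n), then u(m,n) ≤ a(m,n) · Π_{s=m0}^{m-1} [ 1 + Σ_{t=n0}^{n-1} f(s,t) ] for all such (m,n). -/
/-- The product of `1 + F s` over an integer interval, expanded as a telescoping sum. -/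
theorem prod_Icc_one_add_eq_one_add_sum {R : Type*} [CommSemiring R] (F : ℤ → R) (a b : ℤ) :
    ∏ s ∈ Finset.Icc a b, (1 + F s) =
      1 + ∑ s ∈ Finset.Icc a b, F s * ∏ k ∈ Finset.Icc a (s - 1), (1 + F k) := by
  rw [Finset.prod_one_add_ordered]
  congr 1
  refine Finset.sum_congr rfl fun s hs => ?_
  have hfilter : (Finset.Icc a b).filter (· < s) = Finset.Icc a (s - 1) := by
    ext k
    simp only [Finset.mem_filter, Finset.mem_Icc] at hs ⊢
    omega
  rw [hfilter]

/-- Discrete linear Gronwall inequality in two integer variables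
(Theorem 1 specialized to 𝕋₁ = 𝕋₂ = ℤ). -/
theorem gronwall_two_vars_int (m0 n0 : ℤ) (u a f : ℤ → ℤ → ℝ)
    (hu_nonneg : ∀ m, m0 ≤ m → ∀ n, n0 ≤ n → 0 ≤ u m n)
    (ha_nonneg : ∀ m, m0 ≤ m → ∀ n, n0 ≤ n → 0 ≤ a m n)
    (hf_nonneg : ∀ m, m0 ≤ m → ∀ n, n0 ≤ n → 0 ≤ f m n)
    (ha_mono_fst : ∀ n, n0 ≤ n → ∀ m m', m0 ≤ m → m ≤ m' → a m n ≤ a m' n)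
    (ha_mono_snd : ∀ m, m0 ≤ m → ∀ n n', n0 ≤ n → n ≤ n' → a m n ≤ a m n')
    (h : ∀ m, m0 ≤ m → ∀ n, n0 ≤ n →
      u m n ≤ a m n +
        ∑ s ∈ Finset.Icc m0 (m - 1), ∑ t ∈ Finset.Icc n0 (n - 1), f s t * u s t) :
    ∀ m, m0 ≤ m → ∀ n, n0 ≤ n →
      u m n ≤ a m n *
        ∏ s ∈ Finset.Icc m0 (m - 1), (1 + ∑ t ∈ Finset.Icc n0 (n - 1), f s t) := by
  intro m
  induction m using Int.strongRec (m := m0) with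
  | lt m hm => intro hm'; omega
  | ge m hm ih =>
    intro _ n hn
    refine (h m hm n hn).trans ?_
    rw [prod_Icc_one_add_eq_one_add_sum, mul_add, mul_one, Finset.mul_sum]
    gcongr with s hs
    rw [mul_left_comm, Finset.sum_mul]
    refine Finset.sum_le_sum fun t ht => ?_
    rw [Finset.mem_Icc] at hs ht
    have hft := hf_nonneg s hs.1 t ht.1
    refine mul_le_mul_of_nonneg_left ?_ hft
    refine (ih s (by omega) hs.1 t ht.1).trans ?_
    have ha : a s t ≤ a m n :=
      (ha_mono_fst t ht.1 s m hs.1 (by omega)).trans (ha_mono_snd m hm t n ht.1 (by omega))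
    have hF : ∀ k ∈ Finset.Icc m0 (s - 1), 0 ≤ 1 + ∑ r ∈ Finset.Icc n0 (t - 1), f k r := by
      intro k hk
      exact add_nonneg zero_le_one (Finset.sum_nonneg fun r hr =>
        hf_nonneg k (Finset.mem_Icc.1 hk).1 r (Finset.mem_Icc.1 hr).1)
    refine mul_le_mul ha (Finset.prod_le_prod hF fun k hk => ?_) (Finset.prod_nonneg hF)
      (ha_nonneg m hm n hn)
    refine add_le_add le_rfl (Finset.sum_le_sum_of_subset_of_nonneg
      (Finset.Icc_subset_Icc le_rfl (by omega)) fun r hr _ => ?_)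
    exact hf_nonneg k (Finset.mem_Icc.1 hk).1 r (Finset.mem_Icc.1 hr).1
end

section
/- Let m0, n0 be integers and let u, a, f be nonnegative real-valued functions defined for integer pairs (m,n) with m ≥ m0 and n ≥ n0, with a nondecreasing in each of its variables. If u(m,n) ≤ a(m,n) + Σ_{s=m0}^{m-1} Σ_{t=n0}^{n-1} f(s,t) u(s,t) for all such (m,n), then u(m,n) ≤ a(m,n) · Π_{t=n0}^{n-1} [ 1 + Σ_{s=m0}^{m-1} f(s,t) ] for all such (m,n). -/
lemma Int.insert_Icc_sub_one {a k : ℤ} (hk : a ≤ k) :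
    Finset.Icc a (k + 1 - 1) = insert k (Finset.Icc a (k - 1)) := by
  ext x
  simp only [Finset.mem_Icc, Finset.mem_insert]
  omega

lemma Int.prod_Icc_one_add_eq (F : ℤ → ℝ) (a p : ℤ) (hp : a ≤ p) :
    ∏ t ∈ Finset.Icc a (p - 1), (1 + F t) =
      1 + ∑ t ∈ Finset.Icc a (p - 1), F t * ∏ r ∈ Finset.Icc a (t - 1), (1 + F r) := by
  induction p, hp using Int.leInduction with
  | base => simp
  | succ k hk ih =>
    rw [Int.insert_Icc_sub_one hk, Finset.prod_insert (by simp), Finset.sum_insert (by simp)]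
    linear_combination ih

/-- Discrete linear Gronwall inequality in two integer variables,
alternative bound obtained by interchanging the roles of the variables. -/
theorem gronwall_two_vars_int_alt (m0 n0 : ℤ) (u a f : ℤ → ℤ → ℝ)
    (hu_nonneg : ∀ m, m0 ≤ m → ∀ n, n0 ≤ n → 0 ≤ u m n)
    (ha_nonneg : ∀ m, m0 ≤ m → ∀ n, n0 ≤ n → 0 ≤ a m n)
    (hf_nonneg : ∀ m, m0 ≤ m → ∀ n, n0 ≤ n → 0 ≤ f m n)
    (ha_mono_fst : ∀ n, n0 ≤ n → ∀ m m', m0 ≤ m → m ≤ m' → a m n ≤ a m' n)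
    (ha_mono_snd : ∀ m, m0 ≤ m → ∀ n n', n0 ≤ n → n ≤ n' → a m n ≤ a m n')
    (h : ∀ m, m0 ≤ m → ∀ n, n0 ≤ n →
      u m n ≤ a m n +
        ∑ s ∈ Finset.Icc m0 (m - 1), ∑ t ∈ Finset.Icc n0 (n - 1), f s t * u s t) :
    ∀ m, m0 ≤ m → ∀ n, n0 ≤ n →
      u m n ≤ a m n *
        ∏ t ∈ Finset.Icc n0 (n - 1), (1 + ∑ s ∈ Finset.Icc m0 (m - 1), f s t) := by
  intro M hM N hN
  set F : ℤ → ℝ := fun t => ∑ s ∈ Finset.Icc m0 (M - 1), f s t with hF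
  set P : ℤ → ℝ := fun p => ∏ t ∈ Finset.Icc n0 (p - 1), (1 + F t) with hP
  have key : ∀ k, n0 ≤ k → ∀ p, n0 ≤ p → p < k → p ≤ N → ∀ m, m0 ≤ m → m ≤ M →
      u m p ≤ a M N * P p := by
    intro k hk
    induction k, hk using Int.leInduction with
    | base => intro p hp hlt; omega
    | succ k hk ih =>
      intro p hp hpk hpN m hm hmM
      calc u m p ≤ a m p + ∑ s ∈ Finset.Icc m0 (m - 1), ∑ t ∈ Finset.Icc n0 (p - 1),
            f s t * u s t := h m hm p hp
        _ ≤ a M N + ∑ s ∈ Finset.Icc m0 (M - 1), ∑ t ∈ Finset.Icc n0 (p - 1),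
            f s t * (a M N * P t) := by
          apply add_le_add ((ha_mono_fst p hp m M hm hmM).trans (ha_mono_snd M hM p N hp hpN))
          calc _ ≤ ∑ s ∈ Finset.Icc m0 (M - 1), ∑ t ∈ Finset.Icc n0 (p - 1),
                f s t * u s t := by
                refine Finset.sum_le_sum_of_subset_of_nonneg
                  (Finset.Icc_subset_Icc_right (by omega)) fun s hs _ =>
                    Finset.sum_nonneg fun t ht => ?_
                rw [Finset.mem_Icc] at hs ht
                exact mul_nonneg (hf_nonneg s hs.1 t ht.1) (hu_nonneg s hs.1 t ht.1)
            _ ≤ _ := by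
                refine Finset.sum_le_sum fun s hs => Finset.sum_le_sum fun t ht => ?_
                rw [Finset.mem_Icc] at hs ht
                exact mul_le_mul_of_nonneg_left
                  (ih t ht.1 (by omega) (by omega) s hs.1 (by omega))
                  (hf_nonneg s hs.1 t ht.1)
        _ = a M N * P p := by
          simp only [hP]
          rw [Int.prod_Icc_one_add_eq F n0 p hp, mul_add, mul_one, Finset.sum_comm,
            Finset.mul_sum]
          congr 1
          refine Finset.sum_congr rfl fun t _ => ?_
          rw [← Finset.sum_mul]
          ring
  exact key (N + 1) (by omega) N hN (by omega) le_rfl M hM le_rfl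
end

section
/- Let q > 1 be a real number. Let u, a, f be nonnegative real-valued functions of (k, x) ∈ ℕ₀ × [0,∞) (where k indexes the point q^k of the time scale q^{ℕ₀}), continuous in x for each fixed k, with a nondecreasing in each of its variables. If u(k,x) ≤ a(k,x) + Σ_{n=0}^{k-1} (q−1) q^n ∫_0^x f(n,τ) u(n,τ) dτ for all (k,x) ∈ ℕ₀ × [0,∞), then u(k,x) ≤ a(k,x) · Π_{n=0}^{k-1} [ 1 + (q−1) q^n ∫_0^x f(n,τ) dτ ] for all (k,x) ∈ ℕ₀ × [0,∞). -/
/-- Telescoping: the partial products of `1 + g n` expand as a sum. -/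
theorem one_add_sum_mul_prod_one_add {R : Type*} [CommSemiring R] (g : ℕ → R) (k : ℕ) :
    1 + ∑ n ∈ Finset.range k, g n * ∏ m ∈ Finset.range n, (1 + g m) =
      ∏ n ∈ Finset.range k, (1 + g n) := by
  induction k with
  | zero => simp
  | succ k ih => rw [Finset.sum_range_succ, Finset.prod_range_succ, ← add_assoc, ih]; ring

theorem ContinuousOn.intervalIntegrable_zero_of_Ici {f : ℝ → ℝ}
    (hf : ContinuousOn f (Set.Ici 0)) {x : ℝ} (hx : 0 ≤ x) :
    IntervalIntegrable f MeasureTheory.volume 0 x :=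
  (hf.mono fun _ ht => (Set.uIcc_of_le hx ▸ ht).1).intervalIntegrable

/-- Linear Gronwall inequality with 𝕋₁ = q^{ℕ₀} (indexed by k ∈ ℕ₀) and 𝕋₂ = ℝ. -/
theorem gronwall_qscale_real (q : ℝ) (hq : 1 < q) (u a f : ℕ → ℝ → ℝ)
    (hu_cont : ∀ k, ContinuousOn (u k) (Set.Ici 0))
    (ha_cont : ∀ k, ContinuousOn (a k) (Set.Ici 0))
    (hf_cont : ∀ k, ContinuousOn (f k) (Set.Ici 0))
    (hu_nonneg : ∀ k, ∀ x ∈ Set.Ici (0 : ℝ), 0 ≤ u k x)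
    (ha_nonneg : ∀ k, ∀ x ∈ Set.Ici (0 : ℝ), 0 ≤ a k x)
    (hf_nonneg : ∀ k, ∀ x ∈ Set.Ici (0 : ℝ), 0 ≤ f k x)
    (ha_mono_fst : ∀ x ∈ Set.Ici (0 : ℝ), Monotone fun k => a k x)
    (ha_mono_snd : ∀ k, MonotoneOn (a k) (Set.Ici 0))
    (h : ∀ k, ∀ x ∈ Set.Ici (0 : ℝ),
      u k x ≤ a k x +
        ∑ n ∈ Finset.range k, (q - 1) * q ^ n * ∫ τ in (0 : ℝ)..x, f n τ * u n τ) :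
    ∀ k, ∀ x ∈ Set.Ici (0 : ℝ),
      u k x ≤ a k x *
        ∏ n ∈ Finset.range k, (1 + (q - 1) * q ^ n * ∫ τ in (0 : ℝ)..x, f n τ) := by
  have hc : ∀ n : ℕ, 0 ≤ (q - 1) * q ^ n := fun n =>
    mul_nonneg (by linarith) (pow_nonneg (by linarith) n)
  have hF_nonneg : ∀ n, ∀ x : ℝ, 0 ≤ x → 0 ≤ ∫ τ in (0 : ℝ)..x, f n τ := fun n x hx =>
    intervalIntegral.integral_nonneg hx fun t ht => hf_nonneg n t ht.1
  have hF_mono : ∀ n, ∀ t x : ℝ, 0 ≤ t → t ≤ x →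
      ∫ τ in (0 : ℝ)..t, f n τ ≤ ∫ τ in (0 : ℝ)..x, f n τ := fun n t x ht htx =>
    intervalIntegral.integral_mono_interval le_rfl ht htx
      ((MeasureTheory.ae_restrict_mem measurableSet_Ioc).mono
        fun s hs => hf_nonneg n s hs.1.le)
      ((hf_cont n).intervalIntegrable_zero_of_Ici (ht.trans htx))
  intro k
  induction k using Nat.strong_induction_on with
  | _ k ih =>
  intro x hx
  have hx0 : (0 : ℝ) ≤ x := hx
  set g : ℕ → ℝ := fun n => (q - 1) * q ^ n * ∫ τ in (0 : ℝ)..x, f n τ with hg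
  have hbound : ∀ n ∈ Finset.range k, ∀ t ∈ Set.Icc 0 x,
      u n t ≤ a k x * ∏ m ∈ Finset.range n, (1 + g m) := by
    intro n hn t ht
    have hnk := Finset.mem_range.mp hn
    refine (ih n hnk t ht.1).trans (mul_le_mul ?_ ?_ ?_ (ha_nonneg k x hx))
    · exact (ha_mono_snd n ht.1 hx ht.2).trans (ha_mono_fst x hx hnk.le)
    · refine Finset.prod_le_prod (fun m _ => ?_) fun m _ => ?_
      · linarith [mul_nonneg (hc m) (hF_nonneg m t ht.1)]
      · linarith [mul_le_mul_of_nonneg_left (hF_mono m t x ht.1 ht.2) (hc m)]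
    · refine Finset.prod_nonneg fun m _ => ?_
      linarith [mul_nonneg (hc m) (hF_nonneg m t ht.1)]
  have hterm : ∀ n ∈ Finset.range k,
      (q - 1) * q ^ n * ∫ τ in (0 : ℝ)..x, f n τ * u n τ ≤
        a k x * (g n * ∏ m ∈ Finset.range n, (1 + g m)) := by
    intro n hn
    have hint : ∫ τ in (0 : ℝ)..x, f n τ * u n τ ≤
        ∫ τ in (0 : ℝ)..x, f n τ * (a k x * ∏ m ∈ Finset.range n, (1 + g m)) :=
      intervalIntegral.integral_mono_on hx0
        (((hf_cont n).mul (hu_cont n)).intervalIntegrable_zero_of_Ici hx0)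
        (((hf_cont n).intervalIntegrable_zero_of_Ici hx0).mul_const _)
        fun t ht => mul_le_mul_of_nonneg_left (hbound n hn t ht) (hf_nonneg n t ht.1)
    rw [intervalIntegral.integral_mul_const] at hint
    refine (mul_le_mul_of_nonneg_left hint (hc n)).trans_eq ?_
    simp only [hg]
    ring
  calc u k x ≤ a k x + ∑ n ∈ Finset.range k, a k x * (g n * ∏ m ∈ Finset.range n, (1 + g m)) :=
        (h k x hx).trans (add_le_add_right (Finset.sum_le_sum hterm) _)
    _ = a k x * ∏ n ∈ Finset.range k, (1 + g n) := by
        rw [← one_add_sum_mul_prod_one_add, ← Finset.mul_sum]; ring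
end

section
/- Let x0, y0 be real numbers, let u, f be continuous nonnegative real-valued functions on [x0,∞)×[y0,∞), and let a be a continuous strictly positive real-valued function on [x0,∞)×[y0,∞) that is nondecreasing in each of its variables. Let p and q be positive real numbers with p ≥ q. If u(x,y)^p ≤ a(x,y) + ∫_{x0}^{x} ∫_{y0}^{y} f(s,t) u(s,t)^q ds dt for all (x,y) ∈ [x0,∞)×[y0,∞), then u(x,y) ≤ a(x,y)^{1/p} · exp( (1/p) ∫_{x0}^{x} ∫_{y0}^{y} f(s,t) a(s,t)^{q/p − 1} ds dt ) for all (x,y) ∈ [x0,∞)×[y0,∞). -/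
/-- Gronwall's inequality with a continuous coefficient, for an integral function. -/
theorem one_add_integral_le_exp_integral {x0 : ℝ} {B G : ℝ → ℝ} (hB : Continuous B)
    (hG : Continuous G)
    (h : ∀ x, x0 ≤ x → G x ≤ B x * (1 + ∫ s in x0..x, G s)) {x : ℝ} (hx : x0 ≤ x) :
    1 + ∫ s in x0..x, G s ≤ Real.exp (∫ s in x0..x, B s) := by
  have hderiv : ∀ y, HasDerivAt
      (fun y => (1 + ∫ s in x0..y, G s) * Real.exp (-∫ s in x0..y, B s))
      (G y * Real.exp (-∫ s in x0..y, B s) +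
        (1 + ∫ s in x0..y, G s) * (Real.exp (-∫ s in x0..y, B s) * -B y)) y := fun y =>
    ((hG.integral_hasStrictDerivAt x0 y).hasDerivAt.const_add 1).mul
      (hB.integral_hasStrictDerivAt x0 y).hasDerivAt.neg.exp
  have hanti : AntitoneOn
      (fun y => (1 + ∫ s in x0..y, G s) * Real.exp (-∫ s in x0..y, B s)) (Set.Ici x0) := by
    refine antitoneOn_of_hasDerivWithinAt_nonpos (convex_Ici x0)
      (fun y _ => (hderiv y).continuousAt.continuousWithinAt)
      (fun y _ => (hderiv y).hasDerivWithinAt) fun y hy => ?_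
    rw [interior_Ici] at hy
    have := mul_le_mul_of_nonneg_right (h y hy.le) (Real.exp_pos (-∫ s in x0..y, B s)).le
    linarith
  have key := hanti Set.self_mem_Ici (Set.mem_Ici.2 hx) hx
  simp only [intervalIntegral.integral_same, neg_zero, Real.exp_zero, Real.exp_neg] at key
  rw [← div_eq_mul_inv, div_le_iff₀ (Real.exp_pos _)] at key
  simpa using key

theorem continuous_integral_right {g : ℝ → ℝ → ℝ} (hg : Continuous (Function.uncurry g))
    (y0 y : ℝ) : Continuous fun s => ∫ t in y0..y, g s t :=
  intervalIntegral.continuous_parametric_intervalIntegral_of_continuous' hg y0 y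

theorem integral_integral_mono {g k : ℝ → ℝ → ℝ} (hg : Continuous (Function.uncurry g))
    (hk : Continuous (Function.uncurry k)) {x0 y0 x y : ℝ} (hx : x0 ≤ x) (hy : y0 ≤ y)
    (h : ∀ s ∈ Set.Icc x0 x, ∀ t ∈ Set.Icc y0 y, g s t ≤ k s t) :
    ∫ s in x0..x, ∫ t in y0..y, g s t ≤ ∫ s in x0..x, ∫ t in y0..y, k s t :=
  intervalIntegral.integral_mono_on hx
    ((continuous_integral_right hg y0 y).intervalIntegrable _ _)
    ((continuous_integral_right hk y0 y).intervalIntegrable _ _) fun s hs =>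
      intervalIntegral.integral_mono_on hy (hg.uncurry_left s |>.intervalIntegrable _ _)
        (hk.uncurry_left s |>.intervalIntegrable _ _) (h s hs)

/-- Wendroff's inequality: the two-variable version of Gronwall's inequality. -/
theorem one_add_integral_integral_le_exp {x0 y0 : ℝ} {b g : ℝ → ℝ → ℝ}
    (hb : Continuous (Function.uncurry b)) (hg : Continuous (Function.uncurry g))
    (hb0 : ∀ s t, 0 ≤ b s t) (hg0 : ∀ s t, 0 ≤ g s t)
    (h : ∀ x, x0 ≤ x → ∀ y, y0 ≤ y →
      g x y ≤ b x y * (1 + ∫ s in x0..x, ∫ t in y0..y, g s t))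
    {x y : ℝ} (hx : x0 ≤ x) (hy : y0 ≤ y) :
    1 + ∫ s in x0..x, ∫ t in y0..y, g s t ≤
      Real.exp (∫ s in x0..x, ∫ t in y0..y, b s t) := by
  refine one_add_integral_le_exp_integral (continuous_integral_right hb y0 y)
    (continuous_integral_right hg y0 y) (fun s hs => ?_) hx
  rw [← intervalIntegral.integral_mul_const]
  refine intervalIntegral.integral_mono_on hy (hg.uncurry_left s |>.intervalIntegrable _ _)
    (((hb.uncurry_left s).mul continuous_const).intervalIntegrable _ _) fun t ht => ?_
  refine (h s hs t ht.1).trans (mul_le_mul_of_nonneg_left ?_ (hb0 s t))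
  gcongr 1 + ?_
  refine intervalIntegral.integral_mono_on hs
    ((continuous_integral_right hg y0 t).intervalIntegrable _ _)
    ((continuous_integral_right hg y0 y).intervalIntegrable _ _) fun r _ => ?_
  exact intervalIntegral.integral_mono_interval le_rfl ht.1 ht.2
    (Filter.Eventually.of_forall fun _ => hg0 r _)
    (hg.uncurry_left r |>.intervalIntegrable _ _)

/-- The Bihari-type inequality for functions that are continuous on the whole plane. -/
theorem rpow_le_mul_exp_integral_integral {x0 y0 p q : ℝ} {u a f : ℝ → ℝ → ℝ}
    (hp : 0 < p) (hq : 0 < q) (hqp : q ≤ p)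
    (hu : Continuous (Function.uncurry u)) (ha : Continuous (Function.uncurry a))
    (hf : Continuous (Function.uncurry f))
    (hu0 : ∀ s t, 0 ≤ u s t) (ha0 : ∀ s t, 0 < a s t) (hf0 : ∀ s t, 0 ≤ f s t)
    (hamono : ∀ s s' t t', s ≤ s' → t ≤ t' → a s t ≤ a s' t')
    (h : ∀ x, x0 ≤ x → ∀ y, y0 ≤ y →
      u x y ^ p ≤ a x y + ∫ s in x0..x, ∫ t in y0..y, f s t * u s t ^ q)
    {x y : ℝ} (hx : x0 ≤ x) (hy : y0 ≤ y) :
    u x y ^ p ≤ a x y * Real.exp (∫ s in x0..x, ∫ t in y0..y, f s t * a s t ^ (q / p - 1)) := by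
  have hfu : Continuous (Function.uncurry fun s t => f s t * u s t ^ q) :=
    hf.mul (hu.rpow_const fun _ => Or.inr hq.le)
  have hb : Continuous (Function.uncurry fun s t => f s t * a s t ^ (q / p - 1)) :=
    hf.mul (ha.rpow_const fun z => Or.inl (ha0 z.1 z.2).ne')
  have hg : Continuous (Function.uncurry fun s t => f s t * u s t ^ q / a s t) :=
    hfu.div ha fun z => (ha0 z.1 z.2).ne'
  have hg0 : ∀ s t, 0 ≤ f s t * u s t ^ q / a s t := fun s t =>
    div_nonneg (mul_nonneg (hf0 s t) (Real.rpow_nonneg (hu0 s t) q)) (ha0 s t).le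
  have hupz : ∀ x, x0 ≤ x → ∀ y, y0 ≤ y → u x y ^ p ≤
      a x y * (1 + ∫ s in x0..x, ∫ t in y0..y, f s t * u s t ^ q / a s t) := by
    intro x hx y hy
    refine (h x hx y hy).trans ?_
    rw [mul_add, mul_one]
    gcongr a x y + ?_
    simp only [← intervalIntegral.integral_const_mul]
    refine integral_integral_mono hfu (k := fun s t =>
      a x y * (f s t * u s t ^ q / a s t)) (continuous_const.mul hg) hx hy fun s hs t ht => ?_
    calc f s t * u s t ^ q = a s t * (f s t * u s t ^ q / a s t) := by
          rw [mul_div_cancel₀ _ (ha0 s t).ne']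
      _ ≤ _ := mul_le_mul_of_nonneg_right (hamono _ _ _ _ hs.2 ht.2) (hg0 s t)
  refine (hupz x hx y hy).trans (mul_le_mul_of_nonneg_left ?_ (ha0 x y).le)
  refine one_add_integral_integral_le_exp hb hg
    (fun s t => mul_nonneg (hf0 s t) (Real.rpow_nonneg (ha0 s t).le _)) hg0
    (fun x hx y hy => ?_) hx hy
  set z := 1 + ∫ s in x0..x, ∫ t in y0..y, f s t * u s t ^ q / a s t with hz
  have hz1 : 1 ≤ z := le_add_of_nonneg_right <|
    intervalIntegral.integral_nonneg hx fun s _ =>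
      intervalIntegral.integral_nonneg hy fun t _ => hg0 s t
  have huq : u x y ^ q ≤ a x y ^ (q / p) * z :=
    calc u x y ^ q = (u x y ^ p) ^ (q / p) := by
          rw [← Real.rpow_mul (hu0 x y), mul_div_cancel₀ _ hp.ne']
      _ ≤ (a x y * z) ^ (q / p) :=
          Real.rpow_le_rpow (Real.rpow_nonneg (hu0 x y) p) (hupz x hx y hy) (by positivity)
      _ = a x y ^ (q / p) * z ^ (q / p) :=
          Real.mul_rpow (ha0 x y).le (zero_le_one.trans hz1)
      _ ≤ a x y ^ (q / p) * z ^ (1 : ℝ) :=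
          mul_le_mul_of_nonneg_left
            (Real.rpow_le_rpow_of_exponent_le hz1 ((div_le_one hp).2 hqp))
            (Real.rpow_nonneg (ha0 x y).le _)
      _ = a x y ^ (q / p) * z := by rw [Real.rpow_one]
  rw [Real.rpow_sub_one (ha0 x y).ne', div_le_iff₀ (ha0 x y)]
  calc f x y * u x y ^ q ≤ f x y * (a x y ^ (q / p) * z) :=
        mul_le_mul_of_nonneg_left huq (hf0 x y)
    _ = f x y * (a x y ^ (q / p) / a x y) * z * a x y := by
        have := (ha0 x y).ne'
        field_simp

theorem integral_integral_comp_max (x0 y0 : ℝ) (k : ℝ → ℝ → ℝ) {x y : ℝ} (hx : x0 ≤ x)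
    (hy : y0 ≤ y) :
    ∫ s in x0..x, ∫ t in y0..y, k (max x0 s) (max y0 t) =
      ∫ s in x0..x, ∫ t in y0..y, k s t := by
  refine intervalIntegral.integral_congr fun s hs => ?_
  refine intervalIntegral.integral_congr fun t ht => ?_
  rw [Set.uIcc_of_le hx] at hs
  rw [Set.uIcc_of_le hy] at ht
  simp only [max_eq_right hs.1, max_eq_right ht.1]

theorem continuous_uncurry_comp_max {x0 y0 : ℝ} {k : ℝ → ℝ → ℝ}
    (hk : ContinuousOn (fun z : ℝ × ℝ => k z.1 z.2) (Set.Ici x0 ×ˢ Set.Ici y0)) :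
    Continuous (Function.uncurry fun s t => k (max x0 s) (max y0 t)) :=
  hk.comp_continuous (f := fun z : ℝ × ℝ => (max x0 z.1, max y0 z.2)) (by fun_prop)
    fun _ => ⟨Set.mem_Ici.2 (le_max_left _ _), Set.mem_Ici.2 (le_max_left _ _)⟩


/-- Nonlinear Gronwall–Bellman–Bihari inequality in two real variables
(Theorem 3 specialized to 𝕋₁ = 𝕋₂ = ℝ). Powers are real powers. -/
theorem bihari_two_vars_real (x0 y0 : ℝ) (u a f : ℝ → ℝ → ℝ) (p q : ℝ)
    (hp : 0 < p) (hq : 0 < q) (hqp : q ≤ p)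
    (hu_cont : ContinuousOn (fun z : ℝ × ℝ => u z.1 z.2) (Set.Ici x0 ×ˢ Set.Ici y0))
    (ha_cont : ContinuousOn (fun z : ℝ × ℝ => a z.1 z.2) (Set.Ici x0 ×ˢ Set.Ici y0))
    (hf_cont : ContinuousOn (fun z : ℝ × ℝ => f z.1 z.2) (Set.Ici x0 ×ˢ Set.Ici y0))
    (hu_nonneg : ∀ x ∈ Set.Ici x0, ∀ y ∈ Set.Ici y0, 0 ≤ u x y)
    (ha_pos : ∀ x ∈ Set.Ici x0, ∀ y ∈ Set.Ici y0, 0 < a x y)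
    (hf_nonneg : ∀ x ∈ Set.Ici x0, ∀ y ∈ Set.Ici y0, 0 ≤ f x y)
    (ha_mono_fst : ∀ y ∈ Set.Ici y0, MonotoneOn (fun x => a x y) (Set.Ici x0))
    (ha_mono_snd : ∀ x ∈ Set.Ici x0, MonotoneOn (fun y => a x y) (Set.Ici y0))
    (h : ∀ x ∈ Set.Ici x0, ∀ y ∈ Set.Ici y0,
      u x y ^ p ≤ a x y + ∫ s in x0..x, ∫ t in y0..y, f s t * u s t ^ q) :
    ∀ x ∈ Set.Ici x0, ∀ y ∈ Set.Ici y0,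
      u x y ≤ a x y ^ (1 / p) *
        Real.exp ((1 / p) * ∫ s in x0..x, ∫ t in y0..y, f s t * a s t ^ (q / p - 1)) := by
  intro x hx y hy
  have hX : ∀ s, max x0 s ∈ Set.Ici x0 := fun s => Set.mem_Ici.2 (le_max_left _ _)
  have hY : ∀ t, max y0 t ∈ Set.Ici y0 := fun t => Set.mem_Ici.2 (le_max_left _ _)
  have key := rpow_le_mul_exp_integral_integral (x0 := x0) (y0 := y0) hp hq hqp
    (continuous_uncurry_comp_max hu_cont) (continuous_uncurry_comp_max ha_cont)
    (continuous_uncurry_comp_max hf_cont)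
    (fun s t => hu_nonneg _ (hX s) _ (hY t)) (fun s t => ha_pos _ (hX s) _ (hY t))
    (fun s t => hf_nonneg _ (hX s) _ (hY t))
    (fun s s' t t' hs ht =>
      (ha_mono_fst _ (hY t) (hX s) (hX s') (max_le_max_left x0 hs)).trans
        (ha_mono_snd _ (hX s') (hY t) (hY t') (max_le_max_left y0 ht)))
    (fun x hx y hy => by
      rw [integral_integral_comp_max x0 y0 (fun s t => f s t * u s t ^ q) hx hy,
        max_eq_right hx, max_eq_right hy]
      exact h x hx y hy)
    (Set.mem_Ici.1 hx) (Set.mem_Ici.1 hy)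
  rw [integral_integral_comp_max x0 y0 (fun s t => f s t * a s t ^ (q / p - 1)) hx hy,
    max_eq_right hx, max_eq_right hy] at key
  calc u x y = (u x y ^ p) ^ (1 / p) := by
        rw [← Real.rpow_mul (hu_nonneg x hx y hy), mul_one_div_cancel hp.ne', Real.rpow_one]
    _ ≤ _ := Real.rpow_le_rpow (Real.rpow_nonneg (hu_nonneg x hx y hy) p) key (by positivity)
    _ = _ := by
        rw [Real.mul_rpow (ha_pos x hx y hy).le (Real.exp_pos _).le, ← Real.exp_mul,
          mul_comm (1 / p)]
end

section
/- Let m0, n0 be integers, let u, f be nonnegative real-valued functions defined for integer pairs (m,n) with m ≥ m0 and n ≥ n0, and let a be a strictly positive real-valued function on the same domain that is nondecreasing in each of its variables. Let p and q be positive real numbers with p ≥ q. If u(m,n)^p ≤ a(m,n) + Σ_{s=m0}^{m-1} Σ_{t=n0}^{n-1} f(s,t) u(s,t)^q for all such (m,n), then u(m,n) ≤ a(m,n)^{1/p} · ( Π_{s=m0}^{m-1} [ 1 + Σ_{t=n0}^{n-1} f(s,t) a(s,t)^{q/p − 1} ] )^{1/p} for all such (m,n). -/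
/-- Telescoping of a product of factors `1 + g s` over an integer interval. -/
lemma one_add_sum_mul_prod_Icc_int (g : ℤ → ℝ) (k m : ℤ) :
    1 + ∑ s ∈ Finset.Icc k (m - 1), g s * ∏ i ∈ Finset.Icc k (s - 1), (1 + g i) =
      ∏ s ∈ Finset.Icc k (m - 1), (1 + g s) := by
  rw [Finset.prod_one_add_ordered]
  congr 1
  refine Finset.sum_congr rfl fun s hs => ?_
  congr 1
  refine Finset.prod_congr ?_ fun _ _ => rfl
  ext i
  simp only [Finset.mem_Icc, Finset.mem_filter] at hs ⊢
  omega

/-- If `x ^ p ≤ a * P` with `1 ≤ P` and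
`q ≤ p`, then `x ^ q ≤ a ^ (q / p - 1) * a * P`. -/
lemma rpow_le_of_rpow_le_mul {x a P p q : ℝ} (hx : 0 ≤ x) (ha : 0 < a) (hP : 1 ≤ P)
    (hp : 0 < p) (hq : 0 < q) (hqp : q ≤ p) (h : x ^ p ≤ a * P) :
    x ^ q ≤ a ^ (q / p - 1) * a * P := by
  have hP0 : 0 ≤ P := zero_le_one.trans hP
  calc x ^ q = (x ^ p) ^ (q / p) := by
        rw [← Real.rpow_mul hx, mul_div_cancel₀ _ hp.ne']
    _ ≤ (a * P) ^ (q / p) := Real.rpow_le_rpow (Real.rpow_nonneg hx _) h (div_pos hq hp).le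
    _ = a ^ (q / p) * P ^ (q / p) := Real.mul_rpow ha.le hP0
    _ ≤ a ^ (q / p) * P := by
        gcongr
        exact Real.rpow_le_self_of_one_le hP ((div_le_one hp).2 hqp)
    _ = a ^ (q / p - 1) * a * P := by
        rw [Real.rpow_sub_one ha.ne', div_mul_cancel₀ _ ha.ne']

/-- Discrete nonlinear Gronwall–Bellman–Bihari inequality in two integer variables
(Theorem 3 specialized to 𝕋₁ = 𝕋₂ = ℤ). Powers are real powers. -/
theorem bihari_two_vars_int (m0 n0 : ℤ) (u a f : ℤ → ℤ → ℝ) (p q : ℝ)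
    (hp : 0 < p) (hq : 0 < q) (hqp : q ≤ p)
    (hu_nonneg : ∀ m, m0 ≤ m → ∀ n, n0 ≤ n → 0 ≤ u m n)
    (ha_pos : ∀ m, m0 ≤ m → ∀ n, n0 ≤ n → 0 < a m n)
    (hf_nonneg : ∀ m, m0 ≤ m → ∀ n, n0 ≤ n → 0 ≤ f m n)
    (ha_mono_fst : ∀ n, n0 ≤ n → ∀ m m', m0 ≤ m → m ≤ m' → a m n ≤ a m' n)
    (ha_mono_snd : ∀ m, m0 ≤ m → ∀ n n', n0 ≤ n → n ≤ n' → a m n ≤ a m n')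
    (h : ∀ m, m0 ≤ m → ∀ n, n0 ≤ n →
      u m n ^ p ≤ a m n +
        ∑ s ∈ Finset.Icc m0 (m - 1), ∑ t ∈ Finset.Icc n0 (n - 1), f s t * u s t ^ q) :
    ∀ m, m0 ≤ m → ∀ n, n0 ≤ n →
      u m n ≤ a m n ^ (1 / p) *
        (∏ s ∈ Finset.Icc m0 (m - 1),
          (1 + ∑ t ∈ Finset.Icc n0 (n - 1), f s t * a s t ^ (q / p - 1))) ^ (1 / p) := by
  have hg_nonneg : ∀ s, m0 ≤ s → ∀ n, ∀ t ∈ Finset.Icc n0 n,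
      0 ≤ f s t * a s t ^ (q / p - 1) := fun s hs n t ht =>
    mul_nonneg (hf_nonneg s hs t (Finset.mem_Icc.1 ht).1)
      (Real.rpow_nonneg (ha_pos s hs t (Finset.mem_Icc.1 ht).1).le _)
  set P : ℤ → ℤ → ℝ := fun m n => ∏ s ∈ Finset.Icc m0 (m - 1),
    (1 + ∑ t ∈ Finset.Icc n0 (n - 1), f s t * a s t ^ (q / p - 1)) with hP
  have hP_one : ∀ m n, 1 ≤ P m n := fun m n =>
    Finset.one_le_prod fun s hs =>
      le_add_of_nonneg_right (Finset.sum_nonneg (hg_nonneg s (Finset.mem_Icc.1 hs).1 _))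
  have hP_mono : ∀ m n n', n ≤ n' → P m n ≤ P m n' := by
    intro m n n' hn
    refine Finset.prod_le_prod (fun s hs => ?_) fun s hs => ?_
    · exact add_nonneg zero_le_one
        (Finset.sum_nonneg (hg_nonneg s (Finset.mem_Icc.1 hs).1 _))
    · gcongr 1 + ?_
      exact Finset.sum_le_sum_of_subset_of_nonneg
        (Finset.Icc_subset_Icc_right (by omega))
        fun t ht _ => hg_nonneg s (Finset.mem_Icc.1 hs).1 _ t ht
  have key : ∀ k : ℕ, ∀ m, m0 ≤ m → m < m0 + k → ∀ n, n0 ≤ n →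
      u m n ^ p ≤ a m n * P m n := by
    intro k
    induction k with
    | zero => intro m h1 h2; push_cast at h2; omega
    | succ k ih =>
      intro m hm hmk n hn
      push_cast at hmk
      have htel : a m n * P m n = a m n + ∑ s ∈ Finset.Icc m0 (m - 1),
          ∑ t ∈ Finset.Icc n0 (n - 1),
            f s t * (a s t ^ (q / p - 1) * a m n * P s n) := by
        rw [hP]
        simp only
        rw [← one_add_sum_mul_prod_Icc_int, mul_add, mul_one, Finset.mul_sum]
        congr 1
        refine Finset.sum_congr rfl fun s _ => ?_
        rw [Finset.sum_mul, Finset.mul_sum]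
        exact Finset.sum_congr rfl fun t _ => by ring
      rw [htel]
      refine (h m hm n hn).trans ?_
      gcongr with s hs t ht
      · exact hf_nonneg s (Finset.mem_Icc.1 hs).1 t (Finset.mem_Icc.1 ht).1
      obtain ⟨hs0, hsm⟩ := Finset.mem_Icc.1 hs
      obtain ⟨ht0, htn⟩ := Finset.mem_Icc.1 ht
      have ha := ha_pos s hs0 t ht0
      have hle : a s t ≤ a m n :=
        (ha_mono_fst t ht0 s m hs0 (by omega)).trans (ha_mono_snd m hm t n ht0 (by omega))
      refine (rpow_le_of_rpow_le_mul (hu_nonneg s hs0 t ht0) ha (hP_one s t) hp hq hqp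
        (ih s hs0 (by omega) t ht0)).trans ?_
      exact mul_le_mul (mul_le_mul_of_nonneg_left hle (Real.rpow_nonneg ha.le _))
        (hP_mono s t n (by omega)) (zero_le_one.trans (hP_one s t))
        (mul_nonneg (Real.rpow_nonneg ha.le _) (ha.le.trans hle))
  intro m hm n hn
  have hkey := key ((m - m0).toNat + 1) m hm (by push_cast; omega) n hn
  have hu := hu_nonneg m hm n hn
  rw [← Real.mul_rpow (ha_pos m hm n hn).le (zero_le_one.trans (hP_one m n)), one_div]
  exact (Real.le_rpow_inv_iff_of_pos hu
    ((Real.rpow_nonneg hu p).trans hkey) hp).2 hkey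
end

section
/- Let u be a continuous nonnegative real-valued function on [0,∞)×[0,∞), let g : [0,∞) → [0,∞) and h : [0,∞) → [0,∞) be continuous nondecreasing functions with g(0) = 0, h(0) = 0, g(x) > 0 for x > 0 and h(y) > 0 for y > 0, and let F : [0,∞)×[0,∞)×[0,∞) → [0,∞) be continuous with F(s,t,v) ≤ t·v for all s,t,v ≥ 0. Suppose u satisfies the integral equation u(x,y)² = g(x) + h(y) + ∫_0^x ∫_0^y F(s,t,u(s,t)) dt ds for all (x,y) ∈ [0,∞)×[0,∞), and suppose the function (s,t) ↦ t·(g(s)+h(t))^{−1/2} is integrable on [0,x]×[0,y] for all x,y ≥ 0. Then for every (x,y) ∈ [0,∞)×[0,∞) with (x,y) ≠ (0,0), u(x,y) ≤ √(g(x)+h(y)) · exp( (1/2) ∫_0^x ∫_0^y t · (g(s)+h(t))^{−1/2} dt ds ). -/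
open MeasureTheory Set

/-- Monotonicity of iterated integrals of continuous functions over `[0, x] × [0, y]`. -/
theorem iterated_integral_mono_of_continuous {p q : ℝ → ℝ → ℝ}
    (hp : Continuous (Function.uncurry p)) (hq : Continuous (Function.uncurry q))
    {x y : ℝ} (hx : 0 ≤ x) (hy : 0 ≤ y)
    (hpq : ∀ s ∈ Icc 0 x, ∀ t ∈ Icc 0 y, p s t ≤ q s t) :
    ∫ s in (0 : ℝ)..x, ∫ t in (0 : ℝ)..y, p s t ≤
      ∫ s in (0 : ℝ)..x, ∫ t in (0 : ℝ)..y, q s t := by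
  refine intervalIntegral.integral_mono_on hx
    (intervalIntegral.continuous_parametric_intervalIntegral_of_continuous' hp 0 y
      |>.intervalIntegrable _ _)
    (intervalIntegral.continuous_parametric_intervalIntegral_of_continuous' hq 0 y
      |>.intervalIntegrable _ _) fun s hs => ?_
  exact intervalIntegral.integral_mono_on hy
    ((hp.comp (Continuous.prodMk_right s)).intervalIntegrable _ _)
    ((hq.comp (Continuous.prodMk_right s)).intervalIntegrable _ _) fun t ht => hpq s hs t ht

/-- Integral form of Grönwall's inequality with a continuous coefficient. -/
theorem one_add_integral_le_exp_integral_s11 {φ K : ℝ → ℝ} (hφ : Continuous φ) (hK : Continuous K)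
    {X : ℝ} (hX : 0 ≤ X)
    (h : ∀ x ∈ Icc 0 X, φ x ≤ K x * (1 + ∫ s in (0 : ℝ)..x, φ s)) :
    1 + ∫ s in (0 : ℝ)..X, φ s ≤ Real.exp (∫ s in (0 : ℝ)..X, K s) := by
  have hd : ∀ x, HasDerivAt
      (fun x => (1 + ∫ s in (0 : ℝ)..x, φ s) * Real.exp (-∫ s in (0 : ℝ)..x, K s))
      (φ x * Real.exp (-∫ s in (0 : ℝ)..x, K s) +
        (1 + ∫ s in (0 : ℝ)..x, φ s) * (Real.exp (-∫ s in (0 : ℝ)..x, K s) * -K x)) x :=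
    fun x => ((hφ.integral_hasStrictDerivAt 0 x).hasDerivAt.const_add 1).mul
      (hK.integral_hasStrictDerivAt 0 x).hasDerivAt.neg.exp
  have hanti := antitoneOn_of_deriv_nonpos (convex_Icc 0 X)
    (fun x _ => (hd x).continuousAt.continuousWithinAt)
    (fun x _ => (hd x).differentiableAt.differentiableWithinAt) (fun x hx => by
      rw [(hd x).deriv]
      have := mul_le_mul_of_nonneg_right (h x (interior_subset hx))
        (Real.exp_nonneg (-∫ s in (0 : ℝ)..x, K s))
      linarith)
  have := hanti (left_mem_Icc.2 hX) (right_mem_Icc.2 hX) hX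
  simp only [intervalIntegral.integral_same, Real.exp_neg] at this
  rw [← div_eq_mul_inv, div_le_iff₀ (Real.exp_pos _)] at this
  simpa using this

/-- Wendroff-type inequality for `w² ≤ a + ∬ t w` with a positive continuous `a`. -/
theorem sq_le_mul_exp_of_sq_le_add_integral {w a : ℝ → ℝ → ℝ}
    (hw : Continuous (Function.uncurry w)) (ha : Continuous (Function.uncurry a))
    (hw0 : ∀ x y, 0 ≤ w x y) (ha0 : ∀ x y, 0 < a x y)
    (hmono : ∀ s x t y, s ≤ x → t ≤ y → a s t ≤ a x y)
    (hle : ∀ x, 0 ≤ x → ∀ y, 0 ≤ y →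
      w x y ^ 2 ≤ a x y + ∫ s in (0 : ℝ)..x, ∫ t in (0 : ℝ)..y, t * w s t)
    {X Y : ℝ} (hX : 0 ≤ X) (hY : 0 ≤ Y) :
    w X Y ^ 2 ≤ a X Y *
      Real.exp (∫ s in (0 : ℝ)..X, ∫ t in (0 : ℝ)..Y, t / √(a s t)) := by
  set f : ℝ → ℝ → ℝ := fun s t => t * w s t / a s t with hf
  have hk : Continuous (Function.uncurry fun s t => t / √(a s t)) :=
    continuous_snd.div ha.sqrt fun z => (Real.sqrt_pos.2 (ha0 z.1 z.2)).ne'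
  have hfc : Continuous (Function.uncurry f) :=
    (continuous_snd.mul hw).div ha fun z => (ha0 z.1 z.2).ne'
  have hf0 : ∀ s t, 0 ≤ t → 0 ≤ f s t := fun s t ht =>
    div_nonneg (mul_nonneg ht (hw0 s t)) (ha0 s t).le
  have hin : ∀ y, Continuous fun s => ∫ t in (0 : ℝ)..y, f s t := fun y =>
    intervalIntegral.continuous_parametric_intervalIntegral_of_continuous' hfc 0 y
  set R : ℝ → ℝ → ℝ := fun x y => 1 + ∫ s in (0 : ℝ)..x, ∫ t in (0 : ℝ)..y, f s t with hR
  have hR1 : ∀ x, 0 ≤ x → ∀ y, 0 ≤ y → 1 ≤ R x y := fun x hx y hy =>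
    le_add_of_nonneg_right <| intervalIntegral.integral_nonneg hx fun s _ =>
      intervalIntegral.integral_nonneg hy fun t ht => hf0 s t ht.1
  have hRY : ∀ x, 0 ≤ x → ∀ y, 0 ≤ y → y ≤ Y → R x y ≤ R x Y := by
    intro x hx y hy hyY
    refine add_le_add_right (intervalIntegral.integral_mono_on hx
      ((hin y).intervalIntegrable _ _) ((hin Y).intervalIntegrable _ _) fun s _ => ?_) 1
    refine intervalIntegral.integral_mono_interval le_rfl hy hyY ?_
      ((hfc.comp (Continuous.prodMk_right s)).intervalIntegrable _ _)
    filter_upwards [ae_restrict_mem measurableSet_Ioc] with t ht using hf0 s t ht.1.le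
  have hwR : ∀ x, 0 ≤ x → ∀ y, 0 ≤ y → w x y ^ 2 ≤ a x y * R x y := by
    intro x hx y hy
    refine (hle x hx y hy).trans ?_
    simp only [hR, mul_add, mul_one, ← intervalIntegral.integral_const_mul]
    refine add_le_add_right (iterated_integral_mono_of_continuous
      (p := fun s t => t * w s t) (q := fun s t => a x y * f s t) (continuous_snd.mul hw)
      (continuous_const.mul hfc) hx hy fun s hs t ht => ?_) _
    calc t * w s t = a s t * f s t := by
          simp only [hf]; field_simp [(ha0 s t).ne']
      _ ≤ a x y * f s t :=
          mul_le_mul_of_nonneg_right (hmono s x t y hs.2 ht.2) (hf0 s t ht.1)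
  have hfR : ∀ x, 0 ≤ x → ∀ y, 0 ≤ y → f x y ≤ y / √(a x y) * R x y := by
    intro x hx y hy
    have hs := Real.sqrt_pos.2 (ha0 x y)
    have hsq := Real.sq_sqrt (ha0 x y).le
    have h1 := hR1 x hx y hy
    have hw1 : w x y ≤ √(a x y) * R x y := by
      refine abs_le_of_sq_le_sq' ?_ (by positivity) |>.2
      rw [mul_pow, hsq]
      exact (hwR x hx y hy).trans
        (mul_le_mul_of_nonneg_left (by nlinarith) (ha0 x y).le)
    calc f x y ≤ y * (√(a x y) * R x y) / a x y :=
          div_le_div_of_nonneg_right (mul_le_mul_of_nonneg_left hw1 hy) (ha0 x y).le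
      _ = y / √(a x y) * R x y := by
          nth_rw 2 [← hsq]
          field_simp
  refine (hwR X hX Y hY).trans (mul_le_mul_of_nonneg_left ?_ (ha0 X Y).le)
  refine one_add_integral_le_exp_integral_s11 (hin Y)
    (intervalIntegral.continuous_parametric_intervalIntegral_of_continuous' hk 0 Y) hX ?_
  intro x hx
  rw [← intervalIntegral.integral_mul_const]
  refine intervalIntegral.integral_mono_on hY
    ((hfc.comp (Continuous.prodMk_right x)).intervalIntegrable _ _)
    (((hk.comp (Continuous.prodMk_right x)).mul continuous_const).intervalIntegrable _ _)
    fun t ht => (hfR x hx.1 t ht.1).trans ?_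
  exact mul_le_mul_of_nonneg_left (hRY x hx.1 t ht.1 ht.2)
    (div_nonneg ht.1 (Real.sqrt_nonneg _))


/-- Estimate for the solution of the partial dynamic equation
∂²u²/∂x∂y = F(x,y,u), u²(x,0) = g(x), u²(0,y) = h(y), specialized to ℝ,
written as the equivalent integral equation. -/
theorem estimate_solution_ibvp (u : ℝ → ℝ → ℝ) (g h : ℝ → ℝ) (F : ℝ → ℝ → ℝ → ℝ)
    (hu_cont : ContinuousOn (fun z : ℝ × ℝ => u z.1 z.2)
      (Set.Ici (0 : ℝ) ×ˢ Set.Ici (0 : ℝ)))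
    (hu_nonneg : ∀ x, 0 ≤ x → ∀ y, 0 ≤ y → 0 ≤ u x y)
    (hg_cont : ContinuousOn g (Set.Ici 0))
    (hh_cont : ContinuousOn h (Set.Ici 0))
    (hg_mono : MonotoneOn g (Set.Ici 0))
    (hh_mono : MonotoneOn h (Set.Ici 0))
    (hg_nonneg : ∀ x, 0 ≤ x → 0 ≤ g x)
    (hh_nonneg : ∀ y, 0 ≤ y → 0 ≤ h y)
    (hg0 : g 0 = 0) (hh0 : h 0 = 0)
    (hg_pos : ∀ x, 0 < x → 0 < g x)
    (hh_pos : ∀ y, 0 < y → 0 < h y)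
    (hF_cont : ContinuousOn (fun z : ℝ × ℝ × ℝ => F z.1 z.2.1 z.2.2)
      (Set.Ici (0 : ℝ) ×ˢ Set.Ici (0 : ℝ) ×ˢ Set.Ici (0 : ℝ)))
    (hF_nonneg : ∀ s, 0 ≤ s → ∀ t, 0 ≤ t → ∀ v, 0 ≤ v → 0 ≤ F s t v)
    (hF_bound : ∀ s, 0 ≤ s → ∀ t, 0 ≤ t → ∀ v, 0 ≤ v → F s t v ≤ t * v)
    (heq : ∀ x, 0 ≤ x → ∀ y, 0 ≤ y →
      u x y ^ 2 = g x + h y + ∫ s in (0 : ℝ)..x, ∫ t in (0 : ℝ)..y, F s t (u s t))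
    (hint : ∀ x, 0 ≤ x → ∀ y, 0 ≤ y →
      MeasureTheory.IntegrableOn
        (fun z : ℝ × ℝ => z.2 * (g z.1 + h z.2) ^ (-(1 / 2) : ℝ))
        (Set.Icc 0 x ×ˢ Set.Icc 0 y)) :
    ∀ x, 0 ≤ x → ∀ y, 0 ≤ y → (x, y) ≠ ((0 : ℝ), (0 : ℝ)) →
      u x y ≤ Real.sqrt (g x + h y) *
        Real.exp ((1 / 2) *
          ∫ s in (0 : ℝ)..x, ∫ t in (0 : ℝ)..y, t * (g s + h t) ^ (-(1 / 2) : ℝ)) := by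
  intro x hx y hy _
  have hm : ∀ r : ℝ, max r 0 ∈ Ici (0 : ℝ) := fun r => le_max_right r 0
  have hmc : Continuous fun r : ℝ => max r 0 := continuous_id.max continuous_const
  have hgc : Continuous fun s => g (max s 0) := hg_cont.comp_continuous hmc hm
  have hhc : Continuous fun t => h (max t 0) := hh_cont.comp_continuous hmc hm
  have hwc : Continuous (Function.uncurry fun s t => u (max s 0) (max t 0)) :=
    hu_cont.comp_continuous ((hmc.comp continuous_fst).prodMk (hmc.comp continuous_snd))
      fun z => ⟨hm z.1, hm z.2⟩
  have hFc : Continuous (Function.uncurry fun s t =>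
      F (max s 0) (max t 0) (u (max s 0) (max t 0))) :=
    hF_cont.comp_continuous
      ((hmc.comp continuous_fst).prodMk ((hmc.comp continuous_snd).prodMk hwc))
      fun z => ⟨hm z.1, hm z.2, hu_nonneg _ (hm z.1) _ (hm z.2)⟩
  have hle : ∀ x, 0 ≤ x → ∀ y, 0 ≤ y → u x y ^ 2 ≤ g x + h y +
      ∫ s in (0 : ℝ)..x, ∫ t in (0 : ℝ)..y, t * u (max s 0) (max t 0) := by
    intro x hx y hy
    rw [heq x hx y hy]
    refine add_le_add_right ?_ _
    calc ∫ s in (0 : ℝ)..x, ∫ t in (0 : ℝ)..y, F s t (u s t)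
        = ∫ s in (0 : ℝ)..x, ∫ t in (0 : ℝ)..y,
            F (max s 0) (max t 0) (u (max s 0) (max t 0)) := by
          refine intervalIntegral.integral_congr fun s hs => ?_
          refine intervalIntegral.integral_congr fun t ht => ?_
          rw [uIcc_of_le hx] at hs
          rw [uIcc_of_le hy] at ht
          simp only [max_eq_left hs.1, max_eq_left ht.1]
      _ ≤ _ := iterated_integral_mono_of_continuous
          (q := fun s t => t * u (max s 0) (max t 0)) hFc (continuous_snd.mul hwc) hx hy
          fun s hs t ht => by
            simpa only [max_eq_left hs.1, max_eq_left ht.1] using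
              hF_bound s hs.1 t ht.1 (u s t) (hu_nonneg s hs.1 t ht.1)
  set I := ∫ s in (0 : ℝ)..x, ∫ t in (0 : ℝ)..y, t * (g s + h t) ^ (-(1 / 2) : ℝ) with hI
  have hreg : ∀ ε, 0 < ε → u x y ^ 2 ≤ (g x + h y + ε) * Real.exp I := by
    intro ε hε
    have hac : Continuous (Function.uncurry fun s t => g (max s 0) + h (max t 0) + ε) :=
      ((hgc.comp continuous_fst).add (hhc.comp continuous_snd)).add continuous_const
    have ha0 : ∀ s t, 0 < g (max s 0) + h (max t 0) + ε := fun s t =>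
      add_pos_of_nonneg_of_pos (add_nonneg (hg_nonneg _ (hm s)) (hh_nonneg _ (hm t))) hε
    have hkc : Continuous (Function.uncurry fun s t => t / √(g (max s 0) + h (max t 0) + ε)) :=
      continuous_snd.div hac.sqrt fun z => (Real.sqrt_pos.2 (ha0 z.1 z.2)).ne'
    have key := sq_le_mul_exp_of_sq_le_add_integral hwc hac
      (fun s t => hu_nonneg _ (hm s) _ (hm t)) ha0
      (fun s x t y hsx hty => by
        have h1 := hg_mono (hm s) (hm x) (max_le_max_right 0 hsx)
        have h2 := hh_mono (hm t) (hm y) (max_le_max_right 0 hty)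
        linarith)
      (fun x hx y hy => by
        have := hle x hx y hy
        simp only [max_eq_left hx, max_eq_left hy]
        linarith) hx hy
    simp only [max_eq_left hx, max_eq_left hy] at key
    refine key.trans (mul_le_mul_of_nonneg_left (Real.exp_le_exp.2 ?_) ?_)
    · refine intervalIntegral.integral_mono_ae_restrict hx
        (intervalIntegral.continuous_parametric_intervalIntegral_of_continuous' hkc 0 y
          |>.intervalIntegrable _ _) ?_ ?_
      · have := hint x hx y hy
        rw [IntegrableOn, Measure.volume_eq_prod, ← Measure.prod_restrict] at this
        have := this.integral_prod_left
        rw [intervalIntegrable_iff_integrableOn_Icc_of_le hx]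
        simpa only [IntegrableOn, intervalIntegral.integral_of_le hy, ← integral_Icc_eq_integral_Ioc]
          using this
      · have hne : ∀ᵐ s ∂(volume.restrict (Icc 0 x)), s ≠ 0 :=
          ae_restrict_of_ae (Measure.ae_ne volume 0)
        filter_upwards [hne, ae_restrict_mem measurableSet_Icc] with s hs0 hs
        have hgs := hg_pos s (lt_of_le_of_ne hs.1 hs0.symm)
        have hpos : ∀ t ∈ Icc 0 y, 0 < g s + h t := fun t ht =>
          add_pos_of_pos_of_nonneg hgs (hh_nonneg t ht.1)
        refine intervalIntegral.integral_mono_on hy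
          ((hkc.comp (Continuous.prodMk_right s)).intervalIntegrable _ _) ?_ fun t ht => ?_
        · refine ContinuousOn.intervalIntegrable_of_Icc hy ?_
          exact continuousOn_id.mul ((continuousOn_const.add
            (hh_cont.mono Icc_subset_Ici_self)).rpow_const fun t ht => .inl (hpos t ht).ne')
        · rw [max_eq_left hs.1, max_eq_left ht.1, Real.rpow_neg (hpos t ht).le,
            ← Real.sqrt_eq_rpow, ← div_eq_mul_inv]
          exact div_le_div_of_nonneg_left ht.1 (Real.sqrt_pos.2 (hpos t ht))
            (Real.sqrt_le_sqrt (by linarith))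
    · have := hg_nonneg x hx
      have := hh_nonneg y hy
      positivity
  have hlim : u x y ^ 2 ≤ (g x + h y) * Real.exp I := by
    refine le_of_forall_pos_le_add fun ε hε => ?_
    have := hreg (ε / Real.exp I) (by positivity)
    rwa [add_mul, div_mul_cancel₀ _ (Real.exp_pos I).ne'] at this
  have hsum := add_nonneg (hg_nonneg x hx) (hh_nonneg y hy)
  refine abs_le_of_sq_le_sq' ?_ (by positivity) |>.2
  have htwo : ((2 : ℕ) : ℝ) * (1 / 2 * I) = I := by
    push_cast
    ring
  rwa [mul_pow, Real.sq_sqrt hsum, ← Real.exp_nat_mul, htwo]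
end
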